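/- arXiv:2011.05021 — 5 statements merged into one kernel-verified Lean document; each statement's English description precedes it below -/
import Mathlib

section
/- Let k_θ > 0, μ > 0, let c : [t₀, ∞) → ℝ and U : [t₀, ∞) → ℝ be functions with U(t) > 0 for all t, and let x, y : [t₀, ∞) → ℝ be differentiable functions satisfying for all t ≥ t₀ the nominal barycenter path-following error dynamics ẋ(t) = −k_θ·x(t)/√(1+x(t)²) + c(t)·y(t) and ẏ(t) = −U(t)·y(t)/√(μ + x(t)² + 2y(t)²) − c(t)·x(t). Then the function t ↦ x(t)² + y(t)² is nonincreasing on [t₀, ∞); in particular every solution remains in the closed ball of radius √(x(t₀)² + y(t₀)²). -/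
/-- Along the nominal barycenter path-following error dynamics, the squared
norm of the error `t ↦ x(t)² + y(t)²` is nonincreasing on `[t₀, ∞)`. -/
theorem stmt2 (kθ μ t₀ : ℝ) (hkθ : 0 < kθ) (hμ : 0 < μ)
    (c U : ℝ → ℝ) (hUpos : ∀ t, t₀ ≤ t → 0 < U t)
    (x y : ℝ → ℝ)
    (hx : ∀ t, t₀ ≤ t →
      HasDerivAt x (-kθ * x t / Real.sqrt (1 + x t ^ 2) + c t * y t) t)
    (hy : ∀ t, t₀ ≤ t →
      HasDerivAt y
        (-U t * y t / Real.sqrt (μ + x t ^ 2 + 2 * y t ^ 2) - c t * x t) t) :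
    AntitoneOn (fun t => x t ^ 2 + y t ^ 2) (Set.Ici t₀) := by
  have hV : ∀ t, t₀ ≤ t → HasDerivAt (fun t => x t ^ 2 + y t ^ 2)
      (-(2 * (kθ * x t ^ 2 / Real.sqrt (1 + x t ^ 2)
        + U t * y t ^ 2 / Real.sqrt (μ + x t ^ 2 + 2 * y t ^ 2)))) t := by
    intro t ht
    refine (((hx t ht).pow 2).add ((hy t ht).pow 2)).congr_deriv ?_
    push_cast
    ring
  refine antitoneOn_of_hasDerivWithinAt_nonpos (convex_Ici t₀)
    (fun t ht => (hV t ht).continuousAt.continuousWithinAt)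
    (fun t ht => (hV t (interior_subset ht)).hasDerivWithinAt) (fun t ht => ?_)
  have hU := hUpos t (interior_subset ht)
  exact neg_nonpos.mpr (by positivity)
end

section
/- Let k_θ > 0, μ > 0, U_min > 0, let c : [t₀, ∞) → ℝ and U : [t₀, ∞) → ℝ be functions with U(t) ≥ U_min for all t, and let x, y : [t₀, ∞) → ℝ be differentiable functions satisfying for all t ≥ t₀ the nominal barycenter path-following error dynamics ẋ(t) = −k_θ·x(t)/√(1+x(t)²) + c(t)·y(t) and ẏ(t) = −U(t)·y(t)/√(μ + x(t)² + 2y(t)²) − c(t)·x(t). Let r > 0 be such that x(t₀)² + y(t₀)² ≤ r², and set q_min = min( k_θ/√(1+r²), U_min/√(μ + 3r²) ). Then for all t ≥ t₀, √(x(t)² + y(t)²) ≤ √(x(t₀)² + y(t₀)²) · exp(−q_min·(t − t₀)). (Uniform semiglobal exponential stability of the origin of the nominal barycenter error system.) -/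
/-- Comparison principle: `V' ≤ -a V` on `[t₀, ∞)` gives `V t ≤ V t₀ * exp (-a (t - t₀))`. -/
theorem le_mul_exp_of_hasDerivAt_le {V V' : ℝ → ℝ} {a t₀ : ℝ}
    (hV : ∀ t, t₀ ≤ t → HasDerivAt V (V' t) t) (hle : ∀ t, t₀ ≤ t → V' t ≤ -a * V t)
    {t : ℝ} (ht : t₀ ≤ t) : V t ≤ V t₀ * Real.exp (-a * (t - t₀)) := by
  have hd : ∀ s, t₀ ≤ s → HasDerivAt (fun s => V s * Real.exp (a * (s - t₀)))
      ((V' s + a * V s) * Real.exp (a * (s - t₀))) s := fun s hs => by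
    have he : HasDerivAt (fun s => Real.exp (a * (s - t₀)))
        (Real.exp (a * (s - t₀)) * (a * 1)) s :=
      (((hasDerivAt_id s).sub_const t₀).const_mul a).exp
    exact ((hV s hs).mul he).congr_deriv (by ring)
  have hanti : AntitoneOn (fun s => V s * Real.exp (a * (s - t₀))) (Set.Ici t₀) := by
    refine antitoneOn_of_hasDerivWithinAt_nonpos (convex_Ici t₀)
      (fun s hs => (hd s hs).continuousAt.continuousWithinAt)
      (fun s hs => (hd s (interior_subset hs)).hasDerivWithinAt) fun s hs => ?_
    have := hle s (interior_subset hs)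
    exact mul_nonpos_of_nonpos_of_nonneg (by linarith) (Real.exp_pos _).le
  have h := hanti (Set.mem_Ici.2 le_rfl) (Set.mem_Ici.2 ht) ht
  simp only [sub_self, mul_zero, Real.exp_zero, mul_one] at h
  calc V t = V t * Real.exp (a * (t - t₀)) * Real.exp (-a * (t - t₀)) := by
        rw [mul_assoc, ← Real.exp_add]; simp
    _ ≤ V t₀ * Real.exp (-a * (t - t₀)) := by gcongr

/-- Uniform semiglobal exponential stability of the origin of the nominal
barycenter path-following error system: solutions starting in the ball of
radius `r` decay exponentially with rate
`q_min = min( k_θ/√(1+r²), U_min/√(μ + 3r²) )`. -/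
theorem stmt3 (kθ μ Umin t₀ r : ℝ) (hkθ : 0 < kθ) (hμ : 0 < μ)
    (hUmin : 0 < Umin) (hr : 0 < r)
    (c U : ℝ → ℝ) (hU : ∀ t, t₀ ≤ t → Umin ≤ U t)
    (x y : ℝ → ℝ)
    (hx : ∀ t, t₀ ≤ t →
      HasDerivAt x (-kθ * x t / Real.sqrt (1 + x t ^ 2) + c t * y t) t)
    (hy : ∀ t, t₀ ≤ t →
      HasDerivAt y
        (-U t * y t / Real.sqrt (μ + x t ^ 2 + 2 * y t ^ 2) - c t * x t) t)
    (hinit : x t₀ ^ 2 + y t₀ ^ 2 ≤ r ^ 2) :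
    ∀ t, t₀ ≤ t →
      Real.sqrt (x t ^ 2 + y t ^ 2) ≤
        Real.sqrt (x t₀ ^ 2 + y t₀ ^ 2) *
          Real.exp (-(min (kθ / Real.sqrt (1 + r ^ 2))
            (Umin / Real.sqrt (μ + 3 * r ^ 2))) * (t - t₀)) := by
  set q := min (kθ / Real.sqrt (1 + r ^ 2)) (Umin / Real.sqrt (μ + 3 * r ^ 2))
  have hW : ∀ t, t₀ ≤ t → HasDerivAt (fun t => x t ^ 2 + y t ^ 2)
      (-2 * (kθ / Real.sqrt (1 + x t ^ 2) * x t ^ 2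
        + U t / Real.sqrt (μ + x t ^ 2 + 2 * y t ^ 2) * y t ^ 2)) t := fun t ht => by
    exact (((hx t ht).pow 2).add ((hy t ht).pow 2)).congr_deriv (by push_cast; ring)
  have hbound : ∀ t, t₀ ≤ t → x t ^ 2 + y t ^ 2 ≤ r ^ 2 := fun t ht => by
    have h := le_mul_exp_of_hasDerivAt_le (a := 0) hW (fun s hs => by
      have hUs : 0 ≤ U s := hUmin.le.trans (hU s hs)
      have : 0 ≤ kθ / Real.sqrt (1 + x s ^ 2) * x s ^ 2
        + U s / Real.sqrt (μ + x s ^ 2 + 2 * y s ^ 2) * y s ^ 2 := by positivity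
      linarith) ht
    simp only [neg_zero, zero_mul, Real.exp_zero, mul_one] at h
    exact h.trans hinit
  intro t ht
  have hdecay := le_mul_exp_of_hasDerivAt_le (a := 2 * q) hW (fun s hs => by
    have hb := hbound s hs
    have hx2 := sq_nonneg (x s)
    have hy2 := sq_nonneg (y s)
    have h1 : q ≤ kθ / Real.sqrt (1 + x s ^ 2) :=
      (min_le_left _ _).trans (by gcongr kθ / Real.sqrt (1 + ?_); linarith)
    have h2 : q ≤ U s / Real.sqrt (μ + x s ^ 2 + 2 * y s ^ 2) :=
      (min_le_right _ _).trans (div_le_div₀ (hUmin.le.trans (hU s hs)) (hU s hs)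
        (by positivity) (Real.sqrt_le_sqrt (by linarith)))
    have h3 := mul_le_mul_of_nonneg_right h1 hx2
    have h4 := mul_le_mul_of_nonneg_right h2 hy2
    linarith) ht
  refine Real.sqrt_le_iff.2 ⟨by positivity, hdecay.trans_eq ?_⟩
  rw [mul_pow, Real.sq_sqrt (by positivity), ← Real.exp_nat_mul]
  congr 2
  push_cast
  ring
end

section
/- Let k_θ > 0, μ > 0, U_min > 0, G ≥ 0, λ > 0, let c : [t₀, ∞) → ℝ and U : [t₀, ∞) → ℝ be functions with U(t) ≥ U_min for all t, and let g : [t₀, ∞) → ℝ be a function with |g(t)| ≤ G·exp(−λ·(t − t₀)) for all t ≥ t₀. Suppose x, y : [t₀, ∞) → ℝ are differentiable functions satisfying for all t ≥ t₀ the perturbed barycenter error dynamics ẋ(t) = −k_θ·x(t)/√(1+x(t)²) + c(t)·y(t) and ẏ(t) = −U(t)·y(t)/√(μ + x(t)² + 2y(t)²) − c(t)·x(t) + g(t). Then (x, y) is bounded on [t₀, ∞) and (x(t), y(t)) → (0, 0) as t → ∞. (Convergence of the barycenter path-following errors under an exponentially decaying interconnection term from the autopilot error dynamics; this is the cascade conclusion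 of the paper's Theorem 1 for the X̃₁ subsystem.) -/
/-- A function with nonpositive derivative on `[t₀, ∞)` stays below its initial value. -/
lemma le_initial_of_hasDerivAt_nonpos {f f' : ℝ → ℝ} {t₀ : ℝ}
    (hf : ∀ t, t₀ ≤ t → HasDerivAt f (f' t) t) (hf' : ∀ t, t₀ ≤ t → f' t ≤ 0)
    {t : ℝ} (ht : t₀ ≤ t) : f t ≤ f t₀ := by
  have hanti : AntitoneOn f (Set.Ici t₀) := by
    refine antitoneOn_of_deriv_nonpos (convex_Ici t₀)
      (fun s hs => (hf s hs).continuousAt.continuousWithinAt) ?_ ?_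
    all_goals
      intro s hs
      rw [interior_Ici] at hs
    · exact (hf s (le_of_lt hs)).differentiableAt.differentiableWithinAt
    · rw [(hf s (le_of_lt hs)).deriv]
      exact hf' s (le_of_lt hs)
  exact hanti Set.self_mem_Ici ht ht

lemma hasDerivAt_exp_mul_sub (a t₀ t : ℝ) :
    HasDerivAt (fun s => Real.exp (a * (s - t₀))) (a * Real.exp (a * (t - t₀))) t := by
  have h := (((hasDerivAt_id t).sub_const t₀).const_mul a).exp
  simpa [mul_comm] using h

/-- Grönwall-type bound: `W' ≤ G e^{-λ(t - t₀)} W` implies `W ≤ W(t₀) e^{G/λ}`. -/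
lemma le_of_deriv_le_exp_decay_mul {W W' : ℝ → ℝ} {G lam t₀ : ℝ} (hG : 0 ≤ G) (hlam : 0 < lam)
    (hW : ∀ t, t₀ ≤ t → HasDerivAt W (W' t) t) (hW₀ : ∀ t, 0 ≤ W t)
    (hW' : ∀ t, t₀ ≤ t → W' t ≤ G * Real.exp (-lam * (t - t₀)) * W t)
    {t : ℝ} (ht : t₀ ≤ t) : W t ≤ W t₀ * Real.exp (G / lam) := by
  have key := le_initial_of_hasDerivAt_nonpos (t₀ := t₀)
    (fun s hs => (hW s hs).mul (((hasDerivAt_exp_mul_sub (-lam) t₀ s).const_mul (G / lam)).exp))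
    (fun s hs => by
      have h1 : G / lam * (-lam * Real.exp (-lam * (s - t₀))) =
          -(G * Real.exp (-lam * (s - t₀))) := by
        field_simp
      rw [h1]
      have h2 := hW' s hs
      nlinarith [Real.exp_pos (G / lam * Real.exp (-lam * (s - t₀)))]) ht
  simp only [Pi.mul_apply, sub_self, mul_zero, Real.exp_zero, mul_one] at key
  refine le_trans (le_mul_of_one_le_right (hW₀ t) (Real.one_le_exp ?_)) key
  positivity

/-- `V' ≤ -β V + K e^{-λ(t - t₀)}` with `0 < β < λ` forces exponential decay of `V`. -/
lemma le_exp_decay_of_deriv_le {V V' : ℝ → ℝ} {β lam K t₀ : ℝ} (hK : 0 ≤ K) (hβ : β < lam)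
    (hV : ∀ t, t₀ ≤ t → HasDerivAt V (V' t) t)
    (hV' : ∀ t, t₀ ≤ t → V' t ≤ -β * V t + K * Real.exp (-lam * (t - t₀)))
    {t : ℝ} (ht : t₀ ≤ t) :
    V t ≤ (V t₀ + K / (lam - β)) * Real.exp (-β * (t - t₀)) := by
  have hd : 0 < lam - β := sub_pos.2 hβ
  have key := le_initial_of_hasDerivAt_nonpos (t₀ := t₀)
    (fun s hs => ((hV s hs).mul (hasDerivAt_exp_mul_sub β t₀ s)).add
      ((hasDerivAt_exp_mul_sub (-(lam - β)) t₀ s).const_mul (K / (lam - β))))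
    (fun s hs => by
      have h1 : K / (lam - β) * (-(lam - β) * Real.exp (-(lam - β) * (s - t₀))) =
          -(K * Real.exp (-lam * (s - t₀))) * Real.exp (β * (s - t₀)) := by
        have h3 : Real.exp (-(lam - β) * (s - t₀)) =
            Real.exp (-lam * (s - t₀)) * Real.exp (β * (s - t₀)) := by
          rw [← Real.exp_add]
          ring_nf
        rw [h3]
        field_simp
      rw [h1]
      have h2 := hV' s hs
      nlinarith [Real.exp_pos (β * (s - t₀))]) ht
  simp only [Pi.mul_apply, Pi.add_apply, sub_self, mul_zero, Real.exp_zero, mul_one] at key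
  have h4 : V t * Real.exp (β * (t - t₀)) ≤ V t₀ + K / (lam - β) := by
    refine le_trans (le_add_of_nonneg_right ?_) key
    positivity
  calc V t = V t * Real.exp (β * (t - t₀)) * Real.exp (-β * (t - t₀)) := by
        rw [mul_assoc, ← Real.exp_add]
        simp
    _ ≤ _ := by gcongr

lemma tendsto_zero_of_sq_le {ι : Type*} {l : Filter ι} {f V : ι → ℝ}
    (hV : Filter.Tendsto V l (nhds 0)) (h : ∀ t, f t ^ 2 ≤ V t) :
    Filter.Tendsto f l (nhds 0) := by
  have h2 : Filter.Tendsto (fun t => Real.sqrt (V t)) l (nhds 0) := by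
    simpa using hV.sqrt
  exact squeeze_zero_norm (fun t => Real.abs_le_sqrt (h t)) h2


/-- Under an exponentially decaying interconnection term `g` from the autopilot
error dynamics, the barycenter path-following errors remain bounded and
converge to the origin (cascade conclusion for the `X̃₁` subsystem). -/
theorem stmt4 (kθ μ Umin G lam t₀ : ℝ) (hkθ : 0 < kθ) (hμ : 0 < μ)
    (hUmin : 0 < Umin) (hG : 0 ≤ G) (hlam : 0 < lam)
    (c U g : ℝ → ℝ) (hU : ∀ t, t₀ ≤ t → Umin ≤ U t)
    (hg : ∀ t, t₀ ≤ t → |g t| ≤ G * Real.exp (-lam * (t - t₀)))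
    (x y : ℝ → ℝ)
    (hx : ∀ t, t₀ ≤ t →
      HasDerivAt x (-kθ * x t / Real.sqrt (1 + x t ^ 2) + c t * y t) t)
    (hy : ∀ t, t₀ ≤ t →
      HasDerivAt y
        (-U t * y t / Real.sqrt (μ + x t ^ 2 + 2 * y t ^ 2) - c t * x t + g t)
        t) :
    (∃ M : ℝ, ∀ t, t₀ ≤ t → Real.sqrt (x t ^ 2 + y t ^ 2) ≤ M) ∧
    Filter.Tendsto (fun t => (x t, y t)) Filter.atTop
      (nhds ((0 : ℝ), (0 : ℝ))) := by
  have hV : ∀ t, t₀ ≤ t → HasDerivAt (fun s => x s ^ 2 + y s ^ 2)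
      (-(2 * kθ * x t ^ 2 / Real.sqrt (1 + x t ^ 2)) -
        2 * U t * y t ^ 2 / Real.sqrt (μ + x t ^ 2 + 2 * y t ^ 2) + 2 * y t * g t) t := by
    intro t ht
    refine (((hx t ht).pow 2).add ((hy t ht).pow 2)).congr_deriv ?_
    push_cast
    ring
  have hyg : ∀ t, t₀ ≤ t →
      2 * y t * g t ≤ G * Real.exp (-lam * (t - t₀)) * (1 + (x t ^ 2 + y t ^ 2)) := by
    intro t ht
    have h1 : 2 * |y t| ≤ 1 + (x t ^ 2 + y t ^ 2) := by
      nlinarith [sq_nonneg (|y t| - 1), sq_abs (y t), sq_nonneg (x t)]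
    calc 2 * y t * g t ≤ |2 * y t * g t| := le_abs_self _
      _ = |g t| * (2 * |y t|) := by
        rw [abs_mul, abs_mul, abs_two]
        ring
      _ ≤ _ := mul_le_mul (hg t ht) h1 (by positivity) (by positivity)
  set M : ℝ := (1 + (x t₀ ^ 2 + y t₀ ^ 2)) * Real.exp (G / lam) with hM
  have hbound : ∀ t, t₀ ≤ t → 1 + (x t ^ 2 + y t ^ 2) ≤ M := by
    intro t ht
    refine le_of_deriv_le_exp_decay_mul hG hlam (fun s hs => (hV s hs).const_add 1)
      (fun s => by positivity) (fun s hs => ?_) ht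
    have h1 := hyg s hs
    have h2 : 0 ≤ 2 * kθ * x s ^ 2 / Real.sqrt (1 + x s ^ 2) := by positivity
    have hUs : 0 ≤ U s := hUmin.le.trans (hU s hs)
    have h3 : 0 ≤ 2 * U s * y s ^ 2 / Real.sqrt (μ + x s ^ 2 + 2 * y s ^ 2) := by positivity
    linarith
  have hMpos : 0 < M := by positivity
  refine ⟨⟨Real.sqrt M, fun t ht => Real.sqrt_le_sqrt (by linarith [hbound t ht])⟩, ?_⟩
  set α : ℝ := min (2 * kθ / Real.sqrt M) (2 * Umin / Real.sqrt (μ + 2 * M)) with hα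
  have hαpos : 0 < α := lt_min (by positivity) (by positivity)
  set β : ℝ := min α (lam / 2) with hβ
  have hβpos : 0 < β := lt_min hαpos (by positivity)
  have hβlam : β < lam := (min_le_right _ _).trans_lt (by linarith)
  have hdecay : ∀ t, t₀ ≤ t → x t ^ 2 + y t ^ 2 ≤
      (x t₀ ^ 2 + y t₀ ^ 2 + G * M / (lam - β)) * Real.exp (-β * (t - t₀)) := by
    intro t ht
    refine le_exp_decay_of_deriv_le (by positivity) hβlam hV (fun s hs => ?_) ht
    have hb := hbound s hs
    have h1 : 2 * y s * g s ≤ G * M * Real.exp (-lam * (s - t₀)) := by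
      refine (hyg s hs).trans ?_
      rw [mul_right_comm]
      gcongr
    have h2 : β * x s ^ 2 ≤ 2 * kθ * x s ^ 2 / Real.sqrt (1 + x s ^ 2) := by
      rw [mul_div_right_comm]
      gcongr
      refine ((min_le_left _ _).trans (min_le_left _ _)).trans ?_
      gcongr
      nlinarith [sq_nonneg (y s)]
    have h3 : β * y s ^ 2 ≤ 2 * U s * y s ^ 2 / Real.sqrt (μ + x s ^ 2 + 2 * y s ^ 2) := by
      rw [mul_div_right_comm]
      gcongr
      refine ((min_le_left _ _).trans (min_le_right _ _)).trans ?_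
      have hUs : 0 ≤ U s := hUmin.le.trans (hU s hs)
      gcongr 2 * ?_ / Real.sqrt ?_
      · exact hU s hs
      · nlinarith [sq_nonneg (x s)]
    linarith
  have hexp : Filter.Tendsto (fun t => Real.exp (-β * (t - t₀))) Filter.atTop (nhds 0) := by
    refine Real.tendsto_exp_atBot.comp ?_
    exact (Filter.tendsto_atTop_add_const_right _ (-t₀) Filter.tendsto_id).const_mul_atTop_of_neg
      (neg_lt_zero.2 hβpos)
  have hlim : Filter.Tendsto (fun t => x t ^ 2 + y t ^ 2) Filter.atTop (nhds 0) := by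
    refine squeeze_zero' (Filter.Eventually.of_forall fun t => by positivity)
      ((Filter.eventually_ge_atTop t₀).mono hdecay) ?_
    simpa using hexp.const_mul (x t₀ ^ 2 + y t₀ ^ 2 + G * M / (lam - β))
  exact (tendsto_zero_of_sq_le hlim fun t => le_add_of_nonneg_right (sq_nonneg _)).prodMk_nhds
    (tendsto_zero_of_sq_le hlim fun t => le_add_of_nonneg_left (sq_nonneg _))
end

section
/- For all real numbers ψ̃₁, ũ₁, ψ̃₂, ũ₂, ψ₁, ψ₂, γ, a₁, a₂ and all U₁, U₂ ≥ 0, the aggregate interconnection term G₁ = ½·[ ũ₁·sin(ψ₁ − γ) + U₁·(1 − cos ψ̃₁)·sin a₁ + U₁·cos a₁·sin ψ̃₁ ] + ½·[ ũ₂·sin(ψ₂ − γ) + U₂·(1 − cos ψ̃₂)·sin a₂ + U₂·cos a₂·sin ψ̃₂ ] satisfies |G₁| ≤ (1 + 2·max(U₁, U₂)) · √(ψ̃₁² + ũ₁² + ψ̃₂² + ũ₂²). In particular G₁ = 0 whenever ψ̃₁ = ũ₁ = ψ̃₂ = ũ₂ = 0. -/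
theorem Real.one_sub_cos_le_abs (x : ℝ) : 1 - Real.cos x ≤ |x| := by
  rcases le_total |x| 2 with h | h
  · nlinarith [Real.one_sub_sq_div_two_le_cos (x := x), sq_abs x, abs_nonneg x]
  · linarith [Real.neg_one_le_cos x]

/-- The interconnection term of a single vessel grows at most linearly in its autopilot errors. -/
theorem abs_interconnection_le (ψtl utl θ a U : ℝ) (hU : 0 ≤ U) :
    |utl * Real.sin θ + U * (1 - Real.cos ψtl) * Real.sin a + U * Real.cos a * Real.sin ψtl| ≤
      |utl| + 2 * U * |ψtl| := by
  have hu : |utl * Real.sin θ| ≤ |utl| := by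
    rw [abs_mul]
    exact mul_le_of_le_one_right (abs_nonneg _) (Real.abs_sin_le_one θ)
  have hc : |U * (1 - Real.cos ψtl) * Real.sin a| ≤ U * |ψtl| := by
    rw [abs_mul, abs_mul, abs_of_nonneg hU,
      abs_of_nonneg (sub_nonneg.2 (Real.cos_le_one ψtl))]
    calc U * (1 - Real.cos ψtl) * |Real.sin a|
        ≤ U * (1 - Real.cos ψtl) :=
          mul_le_of_le_one_right (mul_nonneg hU (sub_nonneg.2 (Real.cos_le_one ψtl)))
            (Real.abs_sin_le_one a)
      _ ≤ U * |ψtl| := mul_le_mul_of_nonneg_left (Real.one_sub_cos_le_abs ψtl) hU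
  have hs : |U * Real.cos a * Real.sin ψtl| ≤ U * |ψtl| := by
    rw [abs_mul, abs_mul, abs_of_nonneg hU]
    exact mul_le_mul (mul_le_of_le_one_right hU (Real.abs_cos_le_one a)) Real.abs_sin_le_abs
      (abs_nonneg _) hU
  linarith [abs_add_three (utl * Real.sin θ) (U * (1 - Real.cos ψtl) * Real.sin a)
    (U * Real.cos a * Real.sin ψtl)]


/-- Linear growth of the aggregate interconnection term `G₁` in the autopilot
error states of the two vessels, and its vanishing at the origin. -/
theorem stmt6 (ψtl₁ utl₁ ψtl₂ utl₂ ψ₁ ψ₂ γ a₁ a₂ U₁ U₂ : ℝ)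
    (hU₁ : 0 ≤ U₁) (hU₂ : 0 ≤ U₂) :
    |(1 / 2) * (utl₁ * Real.sin (ψ₁ - γ) +
          U₁ * (1 - Real.cos ψtl₁) * Real.sin a₁ +
          U₁ * Real.cos a₁ * Real.sin ψtl₁) +
        (1 / 2) * (utl₂ * Real.sin (ψ₂ - γ) +
          U₂ * (1 - Real.cos ψtl₂) * Real.sin a₂ +
          U₂ * Real.cos a₂ * Real.sin ψtl₂)| ≤
      (1 + 2 * max U₁ U₂) *
        Real.sqrt (ψtl₁ ^ 2 + utl₁ ^ 2 + ψtl₂ ^ 2 + utl₂ ^ 2) ∧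
    (ψtl₁ = 0 → utl₁ = 0 → ψtl₂ = 0 → utl₂ = 0 →
      (1 / 2) * (utl₁ * Real.sin (ψ₁ - γ) +
          U₁ * (1 - Real.cos ψtl₁) * Real.sin a₁ +
          U₁ * Real.cos a₁ * Real.sin ψtl₁) +
        (1 / 2) * (utl₂ * Real.sin (ψ₂ - γ) +
          U₂ * (1 - Real.cos ψtl₂) * Real.sin a₂ +
          U₂ * Real.cos a₂ * Real.sin ψtl₂) = 0) := by
  constructor
  · set S := Real.sqrt (ψtl₁ ^ 2 + utl₁ ^ 2 + ψtl₂ ^ 2 + utl₂ ^ 2)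
    set M := max U₁ U₂
    have hψ₁ : |ψtl₁| ≤ S := Real.abs_le_sqrt (by nlinarith)
    have hu₁ : |utl₁| ≤ S := Real.abs_le_sqrt (by nlinarith)
    have hψ₂ : |ψtl₂| ≤ S := Real.abs_le_sqrt (by nlinarith)
    have hu₂ : |utl₂| ≤ S := Real.abs_le_sqrt (by nlinarith)
    have hM : 0 ≤ M := hU₁.trans (le_max_left U₁ U₂)
    have h₁ : U₁ * |ψtl₁| ≤ M * S := mul_le_mul (le_max_left U₁ U₂) hψ₁ (abs_nonneg _) hM
    have h₂ : U₂ * |ψtl₂| ≤ M * S := mul_le_mul (le_max_right U₁ U₂) hψ₂ (abs_nonneg _) hM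
    have hG₁ := abs_le.1 (abs_interconnection_le ψtl₁ utl₁ (ψ₁ - γ) a₁ U₁ hU₁)
    have hG₂ := abs_le.1 (abs_interconnection_le ψtl₂ utl₂ (ψ₂ - γ) a₂ U₂ hU₂)
    refine abs_le.2 ⟨?_, ?_⟩
    · linarith [hG₁.1, hG₂.1]
    · linarith [hG₁.2, hG₂.2]
  · rintro rfl rfl rfl rfl
    simp
end

section
/- Let c > 0, b ≥ 0, d ≥ 0, and let v : [t₀, ∞) → ℝ be a differentiable function satisfying v(t)·v'(t) ≤ −c·v(t)² + b·|v(t)| + d for all t ≥ t₀. Then for all t ≥ t₀, |v(t)| ≤ max( |v(t₀)|, (b + √(b² + 4cd))/(2c) ). (The sway velocity cannot increase above the threshold at which the negative quadratic term dominates.) -/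
/-- A quadratic with negative leading coefficient is negative beyond its larger root. -/
lemma neg_quadratic_neg_of_larger_root_lt {b c d x : ℝ} (hc : 0 < c)
    (hdisc : 0 ≤ b ^ 2 + 4 * c * d)
    (hx : (b + Real.sqrt (b ^ 2 + 4 * c * d)) / (2 * c) < x) :
    -c * x ^ 2 + b * x + d < 0 := by
  rw [div_lt_iff₀ (by positivity)] at hx
  have hs := Real.sq_sqrt hdisc
  have hs0 := Real.sqrt_nonneg (b ^ 2 + 4 * c * d)
  have hsq : Real.sqrt (b ^ 2 + 4 * c * d) ^ 2 < (2 * c * x - b) ^ 2 :=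
    pow_lt_pow_left₀ (by linarith) hs0 two_ne_zero
  nlinarith

/-- If `v * v'` is negative whenever `|v| = M`, then the band `|v| ≤ M` is forward invariant. -/
lemma abs_le_of_mul_deriv_neg {v v' : ℝ → ℝ} {t₀ M : ℝ}
    (hderiv : ∀ t, t₀ ≤ t → HasDerivAt v (v' t) t) (h₀ : |v t₀| ≤ M)
    (hneg : ∀ t, t₀ ≤ t → |v t| = M → v t * v' t < 0) {t : ℝ} (ht : t₀ ≤ t) :
    |v t| ≤ M := by
  have hM : 0 ≤ M := (abs_nonneg _).trans h₀
  have hsq : ∀ x, t₀ ≤ x → HasDerivAt (fun y => v y ^ 2) (2 * (v x * v' x)) x := fun x hx => by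
    simpa [mul_assoc] using (hderiv x hx).fun_pow 2
  refine abs_le_of_sq_le_sq (image_le_of_deriv_right_lt_deriv_boundary (B := fun _ => M ^ 2)
    (B' := fun _ => 0) (fun x hx => (hsq x hx.1).continuousAt.continuousWithinAt)
    (fun x hx => (hsq x hx.1).hasDerivWithinAt) (sq_le_sq.2 (h₀.trans (le_abs_self M)))
    (fun x => hasDerivAt_const x _) (fun x hx hxM => ?_) (Set.right_mem_Icc.2 ht)) hM
  have habs : |v x| = M := by
    rw [← abs_of_nonneg hM]
    exact (sq_eq_sq_iff_abs_eq_abs _ _).1 hxM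
  linarith [hneg x hx.1 habs]

/-- Invariance estimate behind Lemmas 2 and 3: if along the sway dynamics
`v·v' ≤ −c·v² + b·|v| + d` with `c > 0`, then `|v|` never exceeds the maximum
of its initial value and the larger root of the quadratic. -/
theorem stmt10 (t₀ c b d : ℝ) (hc : 0 < c) (hb : 0 ≤ b) (hd : 0 ≤ d)
    (v v' : ℝ → ℝ)
    (hderiv : ∀ t, t₀ ≤ t → HasDerivAt v (v' t) t)
    (hineq : ∀ t, t₀ ≤ t → v t * v' t ≤ -c * v t ^ 2 + b * |v t| + d) :
    ∀ t, t₀ ≤ t →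
      |v t| ≤ max (|v t₀|) ((b + Real.sqrt (b ^ 2 + 4 * c * d)) / (2 * c)) := by
  intro t ht
  refine le_of_forall_gt_imp_ge_of_dense fun M hM => ?_
  obtain ⟨h₀, hroot⟩ := max_lt_iff.1 hM
  refine abs_le_of_mul_deriv_neg hderiv h₀.le (fun x hx hxM => ?_) ht
  have hquad := neg_quadratic_neg_of_larger_root_lt hc (by positivity) hroot
  rw [← hxM, sq_abs] at hquad
  exact (hineq x hx).trans_lt hquad
end
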